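/- Suppose k_n(s)² + τ_g(s)² > 0 for all s, let θ ∈ (0, π), and suppose that for all s, sin θ · (k_g(s)·(k_n(s)² + τ_g(s)²) + k_n(s)·τ_g'(s) − k_n'(s)·τ_g(s)) = cos θ · (k_n(s)² + τ_g(s)²)^{3/2}. Then the map d(s) := sin θ · (τ_g(s)/√(k_n(s)² + τ_g(s)²))·T(s) − sin θ · (k_n(s)/√(k_n(s)² + τ_g(s)²))·B(s) + cos θ · N(s) has derivative zero; consequently there is a fixed unit vector d₀ with d(s) = d₀ for all s and ⟪N(s), d₀⟫ = cos θ for all s, i.e. α is an isophote with axis d₀ and angle θ. -/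

import Mathlib

open scoped RealInnerProductSpace

noncomputable section

/-- The cross product on `EuclideanSpace ℝ (Fin 3)`. -/
def cross3 (u v : EuclideanSpace ℝ (Fin 3)) : EuclideanSpace ℝ (Fin 3) :=
  (EuclideanSpace.equiv (Fin 3) ℝ).symm
    (crossProduct ((EuclideanSpace.equiv (Fin 3) ℝ) u) ((EuclideanSpace.equiv (Fin 3) ℝ) v))

lemma inner_cross3_left (u v : EuclideanSpace ℝ (Fin 3)) : ⟪cross3 u v, u⟫ = 0 := by
  simp [cross3, cross_apply, PiLp.inner_apply, Fin.sum_univ_three]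
  ring

lemma inner_cross3_right (u v : EuclideanSpace ℝ (Fin 3)) : ⟪cross3 u v, v⟫ = 0 := by
  simp [cross3, cross_apply, PiLp.inner_apply, Fin.sum_univ_three]
  ring

lemma inner_cross3_self (u v : EuclideanSpace ℝ (Fin 3)) :
    ⟪cross3 u v, cross3 u v⟫ = ⟪u, u⟫ * ⟪v, v⟫ - ⟪u, v⟫ ^ 2 := by
  simp [cross3, cross_apply, PiLp.inner_apply, Fin.sum_univ_three,
    -inner_self_eq_norm_sq_to_K]
  ring

lemma ContDiff.cross3 {n : WithTop ℕ∞} {u v : ℝ → EuclideanSpace ℝ (Fin 3)}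
    (hu : ContDiff ℝ n u) (hv : ContDiff ℝ n v) : ContDiff ℝ n fun s => cross3 (u s) (v s) := by
  rw [contDiff_euclidean] at hu hv ⊢
  intro i
  have h0u := hu 0
  have h1u := hu 1
  have h2u := hu 2
  have h0v := hv 0
  have h1v := hv 1
  have h2v := hv 2
  fin_cases i <;> simp [_root_.cross3, cross_apply] <;> fun_prop

/-- A vector orthogonal to three orthonormal vectors of `ℝ³` vanishes. -/
lemma eq_zero_of_inner_orthonormal {e : Fin 3 → EuclideanSpace ℝ (Fin 3)}
    (he : Orthonormal ℝ e) {v : EuclideanSpace ℝ (Fin 3)} (hv : ∀ i, ⟪e i, v⟫ = 0) : v = 0 := by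
  have hc : Fintype.card (Fin 3) = Module.finrank ℝ (EuclideanSpace ℝ (Fin 3)) := by simp
  refine InnerProductSpace.ext_inner_left_basis (𝕜 := ℝ)
    (basisOfOrthonormalOfCardEqFinrank he hc) fun i => ?_
  simpa using hv i

lemma inner_deriv_eq_neg_of_inner_const {E : Type*} [NormedAddCommGroup E]
    [InnerProductSpace ℝ E] {f g : ℝ → E} {c : ℝ} (hf : Differentiable ℝ f)
    (hg : Differentiable ℝ g) (h : ∀ s, ⟪f s, g s⟫ = c) (s : ℝ) :
    ⟪deriv f s, g s⟫ = -⟪deriv g s, f s⟫ := by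
  have h1 := (hf s).hasDerivAt.inner ℝ (hg s).hasDerivAt
  have h2 : (fun t => ⟪f t, g t⟫) = fun _ => c := funext h
  rw [h2] at h1
  have h3 := h1.unique (hasDerivAt_const s c)
  rw [real_inner_comm (f s) (deriv g s)]
  linarith

lemma hasDerivAt_div_sqrt_sq_add_sq {x y : ℝ → ℝ} {x' y' s : ℝ} (hx : HasDerivAt x x' s)
    (hy : HasDerivAt y y' s) (h : 0 < x s ^ 2 + y s ^ 2) :
    HasDerivAt (fun t => y t / √(x t ^ 2 + y t ^ 2))
      (x s * (x s * y' - x' * y s) / √(x s ^ 2 + y s ^ 2) ^ 3) s := by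
  have hr : 0 < √(x s ^ 2 + y s ^ 2) := Real.sqrt_pos.2 h
  have hr2 := Real.sq_sqrt h.le
  refine (hy.div (((hx.pow 2).add (hy.pow 2)).sqrt h.ne') hr.ne').congr_deriv ?_
  simp only [Pi.add_apply, Pi.pow_apply]
  generalize √(x s ^ 2 + y s ^ 2) = r at *
  field_simp
  rw [hr2]
  push_cast
  ring

theorem stmt2
    (α N : ℝ → EuclideanSpace ℝ (Fin 3))
    (hα : ContDiff ℝ (⊤ : ℕ∞) α) (hN : ContDiff ℝ (⊤ : ℕ∞) N)
    (hunit : ∀ s, ‖deriv α s‖ = 1)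
    (hNunit : ∀ s, ‖N s‖ = 1)
    (hNT : ∀ s, ⟪N s, deriv α s⟫ = 0)
    (T B : ℝ → EuclideanSpace ℝ (Fin 3))
    (hT : ∀ s, T s = deriv α s)
    (hB : ∀ s, B s = cross3 (N s) (T s))
    (kn kg τg : ℝ → ℝ)
    (hkn : ∀ s, kn s = ⟪deriv T s, N s⟫)
    (hkg : ∀ s, kg s = ⟪deriv T s, B s⟫)
    (hτg : ∀ s, τg s = ⟪deriv B s, N s⟫)
    (hpos : ∀ s, 0 < kn s ^ 2 + τg s ^ 2)
    (θ : ℝ) (hθ : θ ∈ Set.Ioo 0 Real.pi)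
    (hconst : ∀ s, Real.sin θ *
        (kg s * (kn s ^ 2 + τg s ^ 2) + kn s * deriv τg s - deriv kn s * τg s) =
      Real.cos θ * Real.sqrt ((kn s ^ 2 + τg s ^ 2) ^ 3))
    (dm : ℝ → EuclideanSpace ℝ (Fin 3))
    (hdm : ∀ s, dm s =
        (Real.sin θ * (τg s / Real.sqrt (kn s ^ 2 + τg s ^ 2))) • T s
      - (Real.sin θ * (kn s / Real.sqrt (kn s ^ 2 + τg s ^ 2))) • B s
      + Real.cos θ • N s) :
    (∀ s, deriv dm s = 0) ∧
      ∃ d₀ : EuclideanSpace ℝ (Fin 3), ‖d₀‖ = 1 ∧ (∀ s, dm s = d₀) ∧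
        ∀ s, ⟪N s, d₀⟫ = Real.cos θ := by
  have hTα : T = deriv α := funext hT
  have hBe : B = fun s => cross3 (N s) (T s) := funext hB
  have hTs : ContDiff ℝ (⊤ : ℕ∞) T := by
    rw [hTα]
    exact (contDiff_infty_iff_deriv.1 hα).2
  have hBs : ContDiff ℝ (⊤ : ℕ∞) B := by
    rw [hBe]
    exact hN.cross3 hTs
  have hT's : ContDiff ℝ (⊤ : ℕ∞) (deriv T) := (contDiff_infty_iff_deriv.1 hTs).2
  have hB's : ContDiff ℝ (⊤ : ℕ∞) (deriv B) := (contDiff_infty_iff_deriv.1 hBs).2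
  have hTd : Differentiable ℝ T := hTs.differentiable (by simp)
  have hBd : Differentiable ℝ B := hBs.differentiable (by simp)
  have hNd : Differentiable ℝ N := hN.differentiable (by simp)
  have hknd : Differentiable ℝ kn := by
    rw [funext hkn]
    exact (hT's.inner ℝ hN).differentiable (by simp)
  have hτgd : Differentiable ℝ τg := by
    rw [funext hτg]
    exact (hB's.inner ℝ hN).differentiable (by simp)
  have hTT : ∀ s, ⟪T s, T s⟫ = 1 := fun s => by
    rw [real_inner_self_eq_norm_sq, hT, hunit, one_pow]
  have hNN : ∀ s, ⟪N s, N s⟫ = 1 := fun s => by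
    rw [real_inner_self_eq_norm_sq, hNunit, one_pow]
  have hNT0 : ∀ s, ⟪N s, T s⟫ = 0 := fun s => by rw [hT, hNT]
  have hTN : ∀ s, ⟪T s, N s⟫ = 0 := fun s => by rw [real_inner_comm, hNT0]
  have hBN : ∀ s, ⟪B s, N s⟫ = 0 := fun s => by rw [hB, inner_cross3_left]
  have hNB : ∀ s, ⟪N s, B s⟫ = 0 := fun s => by rw [real_inner_comm, hBN]
  have hBT : ∀ s, ⟪B s, T s⟫ = 0 := fun s => by rw [hB, inner_cross3_right]
  have hTB : ∀ s, ⟪T s, B s⟫ = 0 := fun s => by rw [real_inner_comm, hBT]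
  have hBB : ∀ s, ⟪B s, B s⟫ = 1 := fun s => by
    rw [hB, inner_cross3_self, hNN, hTT, hNT0]
    norm_num
  have frame : ∀ s, Orthonormal ℝ ![T s, B s, N s] := fun s => by
    rw [orthonormal_iff_ite]
    intro i j
    fin_cases i <;> fin_cases j <;>
      simp [hTT, hNN, hBB, hNT0, hTN, hBN, hNB, hBT, hTB,
        -inner_self_eq_norm_sq_to_K]
  have hT'T : ∀ s, ⟪T s, deriv T s⟫ = 0 := fun s => by
    rw [real_inner_comm]
    linarith [inner_deriv_eq_neg_of_inner_const hTd hTd hTT s]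
  have hB'B : ∀ s, ⟪B s, deriv B s⟫ = 0 := fun s => by
    rw [real_inner_comm]
    linarith [inner_deriv_eq_neg_of_inner_const hBd hBd hBB s]
  have hN'N : ∀ s, ⟪N s, deriv N s⟫ = 0 := fun s => by
    rw [real_inner_comm]
    linarith [inner_deriv_eq_neg_of_inner_const hNd hNd hNN s]
  have hT'N : ∀ s, ⟪N s, deriv T s⟫ = kn s := fun s => by rw [hkn, real_inner_comm]
  have hT'B : ∀ s, ⟪B s, deriv T s⟫ = kg s := fun s => by rw [hkg, real_inner_comm]
  have hB'N : ∀ s, ⟪N s, deriv B s⟫ = τg s := fun s => by rw [hτg, real_inner_comm]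
  have hB'T : ∀ s, ⟪T s, deriv B s⟫ = -kg s := fun s => by
    rw [real_inner_comm, inner_deriv_eq_neg_of_inner_const hBd hTd hBT s, hkg]
  have hN'T : ∀ s, ⟪T s, deriv N s⟫ = -kn s := fun s => by
    rw [real_inner_comm, inner_deriv_eq_neg_of_inner_const hNd hTd hNT0 s, hkn]
  have hN'B : ∀ s, ⟪B s, deriv N s⟫ = -τg s := fun s => by
    rw [real_inner_comm, inner_deriv_eq_neg_of_inner_const hNd hBd hNB s, hτg]
  have hdm0 : ∀ s, HasDerivAt dm 0 s := fun s => by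
    have hk := (hknd s).hasDerivAt
    have hτ := (hτgd s).hasDerivAt
    have ha := (hasDerivAt_div_sqrt_sq_add_sq hk hτ (hpos s)).const_mul (Real.sin θ)
    have hb := (hasDerivAt_div_sqrt_sq_add_sq hτ hk
      (by rw [add_comm]; exact hpos s)).const_mul (Real.sin θ)
    simp only [add_comm (τg _ ^ 2)] at hb
    have hd := ((ha.smul (hTd s).hasDerivAt).sub (hb.smul (hBd s).hasDerivAt)).add
      ((hNd s).hasDerivAt.const_smul (Real.cos θ))
    rw [funext hdm]
    refine hd.congr_deriv (eq_zero_of_inner_orthonormal (frame s) fun i => ?_)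
    have hr : 0 < √(kn s ^ 2 + τg s ^ 2) := Real.sqrt_pos.2 (hpos s)
    have hr2 := Real.sq_sqrt (hpos s).le
    have hr3 : √((kn s ^ 2 + τg s ^ 2) ^ 3) = √(kn s ^ 2 + τg s ^ 2) ^ 3 := by
      rw [Real.sqrt_eq_iff_mul_self_eq (pow_nonneg (hpos s).le 3) (by positivity), ← mul_pow,
        Real.mul_self_sqrt (hpos s).le]
    have hc := hconst s
    rw [hr3] at hc
    fin_cases i <;>
      simp only [Fin.zero_eta, Fin.mk_one, Fin.reduceFinMk, Matrix.cons_val, inner_add_right,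
        inner_sub_right, real_inner_smul_right, hTT, hBB, hNT0, hNB, hBT, hTB,
        hT'T, hT'B, hT'N, hB'B, hB'T, hB'N, hN'N, hN'T, hN'B] <;>
      generalize √(kn s ^ 2 + τg s ^ 2) = r at * <;>
      field_simp
    · linear_combination kn s * hc + Real.sin θ * kn s * kg s * hr2
    · linear_combination τg s * hc + Real.sin θ * τg s * kg s * hr2
    · ring
  have hderiv : ∀ s, deriv dm s = 0 := fun s => (hdm0 s).deriv
  have hdmc : ∀ s, dm s = dm 0 := fun s =>
    is_const_of_deriv_eq_zero (fun t => (hdm0 t).differentiableAt) hderiv s 0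
  refine ⟨hderiv, dm 0, ?_, hdmc, fun s => ?_⟩
  · have hr : 0 < √(kn 0 ^ 2 + τg 0 ^ 2) := Real.sqrt_pos.2 (hpos 0)
    have hr2 := Real.sq_sqrt (hpos 0).le
    have h1 : ⟪dm 0, dm 0⟫ = 1 := by
      rw [hdm]
      simp only [inner_add_right, inner_sub_right, real_inner_smul_right, inner_add_left,
        inner_sub_left, real_inner_smul_left, hTT, hNN, hBB, hNT0, hTN, hBN, hNB, hBT, hTB]
      generalize √(kn 0 ^ 2 + τg 0 ^ 2) = r at *
      field_simp
      linear_combination r ^ 2 * Real.sin_sq_add_cos_sq θ - Real.sin θ ^ 2 * hr2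
    rw [real_inner_self_eq_norm_sq] at h1
    exact (pow_eq_one_iff_of_nonneg (norm_nonneg _) two_ne_zero).1 h1
  · rw [← hdmc s, hdm]
    simp [inner_add_right, inner_sub_right, real_inner_smul_right, hNN, hNT0, hNB,
      -inner_self_eq_norm_sq_to_K]
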